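/- Let G be a simple graph on a finite nonempty vertex set V, assume G is connected, and let w be a real-valued weight function on the edges of G that is injective (all edge weights are pairwise distinct). Let the vertex set be partitioned into nonempty blocks (the trees of the current forest), and suppose the blocks T_p and T_q are distinct, joined by at least one edge of G, and mutually nearest: the minimum weight of an edge of G between T_p and T_q is less than or equal to the weight of every edge of G joining T_p to any block other than T_p, and likewise less than or equal to the weight of every edge of G joining T_q to any block other than T_q. Then the minimum-weight edge between T_p and T_q belongs to every minimum spanning tree of G. -/

import Mathlib

namespace SimpleGraph

variable {V : Type*}

lemma edgeSet_sup_edge_deleteEdges {T : SimpleGraph V} {a b : V} (hab : a ≠ b) (e : Sym2 V) :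
    ((T ⊔ edge a b).deleteEdges {e}).edgeSet = insert s(a, b) T.edgeSet \ {e} := by
  rw [edgeSet_deleteEdges, edgeSet_sup, edgeSet_edge_of_ne hab, Set.union_singleton]

/-- Adding an edge to a tree and removing an edge of the path joining its endpoints
gives a tree. -/
lemma IsTree.sup_edge_deleteEdges [Finite V] {T : SimpleGraph V} (hT : T.IsTree) {a b : V}
    (hab : a ≠ b) (hnadj : ¬ T.Adj a b) {P : T.Walk a b} (hP : P.IsPath) {e : Sym2 V}
    (he : e ∈ P.edges) : ((T ⊔ edge a b).deleteEdges {e}).IsTree := by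
  have heT : e ∈ T.edgeSet := P.edges_subset_edgeSet he
  have hba : (T ⊔ edge a b).Adj b a := Or.inr ((edge_adj ..).2 ⟨Or.inr ⟨rfl, rfl⟩, hab.symm⟩)
  have hcycle : (Walk.cons hba (P.mapLe le_sup_left)).IsCycle := by
    rw [Walk.cons_isCycle_iff, Walk.edges_mapLe_eq_edges]
    exact ⟨hP.mapLe _, fun h ↦ hnadj (P.edges_subset_edgeSet h).symm⟩
  have hconn : ((T ⊔ edge a b).deleteEdges {e}).Connected := by
    induction e with | _ x y
    refine (hT.connected.mono le_sup_left).connected_delete_edge_of_not_isBridge fun hb ↦ ?_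
    exact hb.notMem_edges_of_isCycle hcycle (by simp [he])
  refine isTree_iff_connected_and_card.2 ⟨hconn, ?_⟩
  rw [edgeSet_sup_edge_deleteEdges hab, Nat.card_coe_set_eq, Set.ncard_exchange' (mt T.mem_edgeSet.1 hnadj) heT,
    ← Nat.card_coe_set_eq]
  exact (isTree_iff_connected_and_card.1 hT).2

end SimpleGraph

/-- Exchanging an element of a set for a new one of smaller weight lowers the total weight. -/
lemma finsum_mem_exchange_lt {α : Type*} {s : Set α} (hs : s.Finite) (f : α → ℝ) {a b : α}
    (ha : a ∉ s) (hb : b ∈ s) (hlt : f a < f b) :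
    ∑ᶠ e ∈ insert a s \ {b}, f e < ∑ᶠ e ∈ s, f e := by
  have hab : a ≠ b := fun h ↦ ha (h ▸ hb)
  rw [Set.insert_sdiff_of_notMem _ (by simpa using hab),
    finsum_mem_insert f (fun h ↦ ha h.1) hs.sdiff]
  conv_rhs => rw [← Set.insert_sdiff_self_of_mem hb,
    finsum_mem_insert f (Set.notMem_sdiff_of_mem (Set.mem_singleton b)) hs.sdiff]
  gcongr


/-- Key step in Theorem 1 of the paper.  Let `G` be a connected simple graph on a
finite nonempty vertex set with pairwise-distinct edge weights `w`, and let the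
vertices be partitioned into blocks, given as the fibers of `c : V → ι` (vertex `v`
belongs to the block `c v`).  Suppose the distinct blocks `T_p = c⁻¹' {p}` and
`T_q = c⁻¹' {q}` are joined by at least one edge of `G` and are mutually nearest:
the minimum-weight edge `{a₀, b₀}` between `T_p` and `T_q` has weight at most the
weight of every edge joining `T_p` to any other block, and at most the weight of
every edge joining `T_q` to any other block.  Then the edge `{a₀, b₀}` — the
reliable single-linkage established between the mutually nearest trees `T_p` and
`T_q` — belongs to every minimum spanning tree of `G`. -/
theorem reliable_single_linkage_mem_mst {V : Type*} [Fintype V] [Nonempty V]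
    (G : SimpleGraph V) (hG : G.Connected) (w : Sym2 V → ℝ)
    (hw : Set.InjOn w G.edgeSet)
    {ι : Type*} (c : V → ι) (p q : ι) (hpq : p ≠ q)
    (a₀ b₀ : V) (hadj : G.Adj a₀ b₀) (ha₀ : c a₀ = p) (hb₀ : c b₀ = q)
    (hminpq : ∀ a b : V, G.Adj a b → c a = p → c b = q → w s(a₀, b₀) ≤ w s(a, b))
    (hminp : ∀ a b : V, G.Adj a b → c a = p → c b ≠ p → w s(a₀, b₀) ≤ w s(a, b))
    (hminq : ∀ a b : V, G.Adj a b → c a = q → c b ≠ q → w s(a₀, b₀) ≤ w s(a, b)) :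
    ∀ T : SimpleGraph V, T ≤ G → T.IsTree →
      (∀ T' : SimpleGraph V, T' ≤ G → T'.IsTree →
        ∑ᶠ e ∈ T.edgeSet, w e ≤ ∑ᶠ e ∈ T'.edgeSet, w e) →
      T.Adj a₀ b₀ := by
  intro T hTG hT hmin
  by_contra hnadj
  obtain ⟨P, hP⟩ := hT.connected.exists_isPath a₀ b₀
  obtain ⟨d, hd, hdp, hdnp⟩ := P.exists_boundary_dart {v | c v = p} ha₀
    (fun h ↦ hpq (h.symm.trans hb₀))
  have hde : d.edge ∈ P.edges := List.mem_map_of_mem hd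
  have hdT : d.edge ∈ T.edgeSet := d.edge_mem
  have hle : w s(a₀, b₀) ≤ w d.edge := hminp d.fst d.snd (hTG d.adj) hdp hdnp
  have hlt : w s(a₀, b₀) < w d.edge := by
    refine hle.lt_of_ne fun h ↦ hnadj ?_
    rw [← SimpleGraph.mem_edgeSet, hw hadj (SimpleGraph.edgeSet_mono hTG hdT) h]
    exact hdT
  have hle' : (T ⊔ SimpleGraph.edge a₀ b₀).deleteEdges {d.edge} ≤ G :=
    (SimpleGraph.deleteEdges_le _).trans (sup_le hTG ((G.edge_le_iff).2 (Or.inr hadj)))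
  have hsum := hmin _ hle' (hT.sup_edge_deleteEdges hadj.ne hnadj hP hde)
  rw [SimpleGraph.edgeSet_sup_edge_deleteEdges hadj.ne] at hsum
  exact hsum.not_gt (finsum_mem_exchange_lt (Set.toFinite _) w hnadj hdT hlt)
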